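/- arXiv:0911.5478 — 8 statements merged into one kernel-verified Lean document; each statement's English description precedes it below -/
import Mathlib

section
/- Suppose there are infinitely many fundamental points of the sequence a, i.e., infinitely many integers m ≥ 180 with m ≡ 0 (mod 6) and a(m) = 2m. Then there are infinitely many pairs of twin primes, i.e., infinitely many primes p such that p + 2 is also prime. -/
/-- Auxiliary sequence: `aAux k = a (180 + k)`, where `a 180 = 360` and, for `n ≥ 181`,
`a n = a (n-1) + 1` if `gcd (n + (-1)^n - 1, a (n-1)) = 1` (this first argument is `n`
for even `n` and `n - 2` for odd `n`), and `a n = 3 (n - 2)` otherwise. -/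
def aAux : ℕ → ℕ
  | 0 => 360
  | k + 1 =>
    if Nat.gcd (if (181 + k) % 2 = 0 then 181 + k else 179 + k) (aAux k) = 1 then
      aAux k + 1
    else 3 * (179 + k)

/-- The sequence `a` of the paper, defined for `n ≥ 180` (junk value below 180). -/
def a (n : ℕ) : ℕ := aAux (n - 180)

/-- A fundamental point of `a`: an integer `m ≥ 180` with `m ≡ 0 (mod 6)` and `a m = 2 m`. -/
def IsFundamentalA (m : ℕ) : Prop := 180 ≤ m ∧ m % 6 = 0 ∧ a m = 2 * m

/-- Either the sequence has not jumped yet, or it has grown by steps of one since its last jump,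
which happened at index `181 + s`. -/
theorem aAux_eq_or_exists_last_jump (k : ℕ) :
    aAux k = 360 + k ∨ ∃ s < k, (∀ j, s < j → j ≤ k → aAux j = 536 + 2 * s + j) ∧
      ∀ j, s < j → j < k →
        Nat.gcd (if (181 + j) % 2 = 0 then 181 + j else 179 + j) (aAux j) = 1 := by
  induction k with
  | zero => exact Or.inl rfl
  | succ k ih =>
    by_cases hg : Nat.gcd (if (181 + k) % 2 = 0 then 181 + k else 179 + k) (aAux k) = 1
    · have hk : aAux (k + 1) = aAux k + 1 := by rw [aAux, if_pos hg]
      rcases ih with h | ⟨s, hs, hval, hgcd⟩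
      · left; omega
      · refine Or.inr ⟨s, by omega, fun j hj hjk => ?_, fun j hj hjk => ?_⟩
        · rcases Nat.lt_succ_iff_lt_or_eq.mp (Nat.lt_succ_of_le hjk) with hlt | rfl
          · exact hval j hj (by omega)
          · have := hval k hs le_rfl
            omega
        · rcases Nat.lt_succ_iff_lt_or_eq.mp hjk with hlt | rfl
          · exact hgcd j hj hlt
          · exact hg
    · have hk : aAux (k + 1) = 3 * (179 + k) := by rw [aAux, if_neg hg]
      refine Or.inr ⟨k, by omega, fun j hj hjk => ?_, fun j hj hjk => by omega⟩
      obtain rfl : j = k + 1 := by omega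
      omega

/-- A fundamental point other than `180` has the form `2 * r - 6`, where `r` is the index of the
last jump before it; the absence of later jumps is expressed by coprimality conditions. -/
theorem IsFundamentalA.exists_jump {m : ℕ} (hm : IsFundamentalA m) (h180 : m ≠ 180) :
    ∃ r, 181 ≤ r ∧ m = 2 * r - 6 ∧
      (∀ n, r < n → n ≤ m → n % 2 = 0 → Nat.Coprime n (m - 1)) ∧
      ∀ d, r < d + 2 → d + 2 ≤ m → d % 2 = 1 → Nat.Coprime d (m + 1) := by
  obtain ⟨hle, -, ha⟩ := hm
  rw [a] at ha
  rcases aAux_eq_or_exists_last_jump (m - 180) with h | ⟨s, hs, hval, hgcd⟩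
  · omega
  have hmval := hval _ hs le_rfl
  refine ⟨181 + s, by omega, by omega, fun n hrn hnm hn => ?_, fun d hrd hdm hd => ?_⟩
  · have h := hgcd (n - 181) (by omega) (by omega)
    rw [if_pos (by omega), hval _ (by omega) (by omega), show 181 + (n - 181) = n by omega,
      show 536 + 2 * s + (n - 181) = (m - 1) + n by omega] at h
    simpa using h
  · have h := hgcd (d - 179) (by omega) (by omega)
    rw [if_neg (by omega), hval _ (by omega) (by omega), show 179 + (d - 179) = d by omega,
      show 536 + 2 * s + (d - 179) = (m + 1) + d by omega] at h
    simpa using h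

/-- An odd number between `2` and `2 * r - 5` that is not prime has a small odd prime factor. -/
theorem exists_small_odd_prime_dvd {r N : ℕ} (hr : 181 ≤ r) (hN : 2 ≤ N) (hNr : N ≤ 2 * r - 5)
    (hodd : N % 2 = 1) (hnp : ¬ N.Prime) :
    ∃ p, p.Prime ∧ p % 2 = 1 ∧ p ∣ N ∧ 2 * p + 6 ≤ r := by
  refine ⟨N.minFac, Nat.minFac_prime (by omega), ?_, N.minFac_dvd, ?_⟩
  · exact Nat.odd_iff.mp ((Nat.odd_iff.mpr hodd).of_dvd_nat N.minFac_dvd)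
  · have h := Nat.minFac_sq_le_self (by omega) hnp
    obtain ⟨t, rfl⟩ := Nat.exists_eq_add_of_le hr
    by_contra hlt
    have h1 : t + 176 ≤ 2 * N.minFac := by omega
    have h2 : N ≤ 2 * t + 357 := by omega
    nlinarith

theorem IsFundamentalA.twin_primes {m : ℕ} (hm : IsFundamentalA m) (h180 : m ≠ 180) :
    (m - 1).Prime ∧ (m + 1).Prime := by
  obtain ⟨r, hr, hmr, heven, hodd⟩ := hm.exists_jump h180
  constructor
  · by_contra hnp
    obtain ⟨p, hp, -, hpd, hpr⟩ :=
      exists_small_odd_prime_dvd (N := m - 1) hr (by omega) (by omega) (by omega) hnp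
    have hdiv := Nat.div_add_mod m (2 * p)
    have hmod := Nat.mod_lt m (show 0 < 2 * p by have := hp.pos; omega)
    have hcop := heven (2 * p * (m / (2 * p))) (by omega) (by omega) (by simp [mul_assoc])
    exact Nat.not_coprime_of_dvd_of_dvd hp.one_lt
      ⟨2 * (m / (2 * p)), by ring⟩ hpd hcop
  · by_contra hnp
    obtain ⟨p, hp, hp2, hpd, hpr⟩ :=
      exists_small_odd_prime_dvd (N := m + 1) hr (by omega) (by omega) (by omega) hnp
    have hdiv := Nat.div_add_mod (m - 2 + p) (2 * p)
    have hmod := Nat.mod_lt (m - 2 + p) (show 0 < 2 * p by have := hp.pos; omega)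
    set q := (m - 2 + p) / (2 * p)
    have heven' : (2 * p * q) % 2 = 0 := by simp [mul_assoc]
    have hcop := hodd (2 * p * q - p) (by omega) (by omega) (by omega)
    exact Nat.not_coprime_of_dvd_of_dvd hp.one_lt
      (Nat.dvd_sub ⟨2 * q, by ring⟩ dvd_rfl) hpd hcop

/-- If the sequence `a` has infinitely many fundamental points, then there are
infinitely many pairs of twin primes. -/
theorem infinitely_many_twin_primes_of_infinitely_many_fundamental_points_a
    (h : {m : ℕ | IsFundamentalA m}.Infinite) :
    {p : ℕ | Nat.Prime p ∧ Nat.Prime (p + 2)}.Infinite := by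
  refine Set.infinite_of_injOn_mapsTo (f := fun m => m - 1) ?_ ?_
    (h.sdiff (Set.finite_singleton 180))
  · rintro x ⟨⟨hx, -⟩, -⟩ y ⟨⟨hy, -⟩, -⟩ hxy
    dsimp only at hxy
    omega
  · rintro m ⟨hm, h180⟩
    obtain ⟨h1, h2⟩ := hm.twin_primes h180
    have := hm.1
    exact ⟨h1, by rwa [show m - 1 + 2 = m + 1 by omega]⟩
end

section
/- Let m ≥ 180 be a fundamental point of the sequence a such that m - 1 and m + 1 are both prime, and let m' be the least fundamental point of a with m' > m (assuming one exists). Then m' - 1 and m' + 1 are both prime. -/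
theorem a_succ {n : ℕ} (hn : 180 ≤ n) :
    a (n + 1) = if Nat.gcd (if (n + 1) % 2 = 0 then n + 1 else n - 1) (a n) = 1
      then a n + 1 else 3 * (n - 1) := by
  obtain ⟨k, rfl⟩ := Nat.exists_eq_add_of_le hn
  have h₁ : 180 + k + 1 - 180 = k + 1 := by omega
  have h₂ : 180 + k - 180 = k := by omega
  have h₃ : 180 + k - 1 = 179 + k := by omega
  have h₄ : 180 + k + 1 = 181 + k := by omega
  simp only [a, h₁, h₂, h₃, aAux]
  rw [h₄]

theorem a_succ_of_odd {n : ℕ} (hn : 180 ≤ n) (hpar : n % 2 = 1) :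
    a (n + 1) = if Nat.gcd (n + 1) (a n) = 1 then a n + 1 else 3 * (n - 1) := by
  simp only [a_succ hn, show (n + 1) % 2 = 0 by omega, if_true]

theorem a_succ_of_even {n : ℕ} (hn : 180 ≤ n) (hpar : n % 2 = 0) :
    a (n + 1) = if Nat.gcd (n - 1) (a n) = 1 then a n + 1 else 3 * (n - 1) := by
  simp only [a_succ hn, show ¬(n + 1) % 2 = 0 by omega, if_false]

/-- The run of increments of `a` that starts at a reset point `r` and lasts up to `n`. -/
def IsRun (r n : ℕ) : Prop :=
  a n + 6 = n + 2 * r ∧ ∀ j, r < j → j ≤ n →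
    (j % 2 = 0 → Nat.Coprime j (2 * r - 7)) ∧ (j % 2 = 1 → Nat.Coprime (j - 2) (2 * r - 5))

theorem IsRun.step {r n : ℕ} (hr : 180 ≤ r) (hrn : r ≤ n) (h : IsRun r n) :
    IsRun r (n + 1) ∨ IsRun (n + 1) (n + 1) := by
  obtain ⟨ha, hrun⟩ := h
  have hs := a_succ (hr.trans hrn)
  split_ifs at hs with hpar hgcd hgcd
  · refine .inl ⟨by omega, fun j hj hjn => ?_⟩
    obtain hjn | rfl : j ≤ n ∨ j = n + 1 := by omega
    · exact hrun j hj hjn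
    · refine ⟨fun _ => ?_, fun _ => by omega⟩
      have e : a n = (2 * r - 7) + (n + 1) := by omega
      simpa only [e, Nat.gcd_add_self_right, ← Nat.coprime_iff_gcd_eq_one] using hgcd
  · exact .inr ⟨by omega, fun j hj hjn => by omega⟩
  · refine .inl ⟨by omega, fun j hj hjn => ?_⟩
    obtain hjn | rfl : j ≤ n ∨ j = n + 1 := by omega
    · exact hrun j hj hjn
    · refine ⟨fun _ => by omega, fun _ => ?_⟩
      have e : a n = (2 * r - 5) + (n - 1) := by omega
      have e' : n + 1 - 2 = n - 1 := by omega
      simpa only [e, e', Nat.gcd_add_self_right, ← Nat.coprime_iff_gcd_eq_one] using hgcd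
  · exact .inr ⟨by omega, fun j hj hjn => by omega⟩

theorem exists_isRun {s n : ℕ} (hs : 180 ≤ s) (h : IsRun s s) (hn : s ≤ n) :
    ∃ r, s ≤ r ∧ r ≤ n ∧ IsRun r n := by
  induction n, hn using Nat.le_induction with
  | base => exact ⟨s, le_rfl, le_rfl, h⟩
  | succ n _ ih =>
    obtain ⟨r, hsr, hrn, hr⟩ := ih
    rcases hr.step (hs.trans hsr) hrn with h' | h'
    · exact ⟨r, hsr, by omega, h'⟩
    · exact ⟨n + 1, by omega, le_rfl, h'⟩

theorem IsFundamentalA.isRun_add_three {m : ℕ} (hm : IsFundamentalA m) :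
    IsRun (m + 3) (m + 3) := by
  obtain ⟨hm, hmod, ha⟩ := hm
  have h₁ : a (m + 1) = 2 * m + 1 := by
    rw [a_succ_of_even hm (by omega), ha, if_pos]
    have hodd : Nat.Coprime (m - 1) 2 := Nat.coprime_two_right.mpr (by grind)
    have hself : Nat.Coprime (m - 1) m :=
      ((Nat.coprime_self_sub_right (by omega : 1 ≤ m)).mpr (Nat.coprime_one_right m)).symm
    exact hodd.mul_right hself
  have h₂ : a (m + 2) = 2 * m + 2 := by
    rw [a_succ_of_odd (by omega) (by omega), h₁, if_pos]
    have hthree : Nat.Coprime 3 (m + 2) :=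
      (Nat.Prime.coprime_iff_not_dvd Nat.prime_three).mpr (by omega)
    have hdvd : Nat.gcd (m + 1 + 1) (2 * m + 1) ∣ 3 := by
      have h := Nat.dvd_sub ((Nat.gcd_dvd_left (m + 1 + 1) (2 * m + 1)).mul_left 2)
        (Nat.gcd_dvd_right (m + 1 + 1) (2 * m + 1))
      rwa [show 2 * (m + 1 + 1) - (2 * m + 1) = 3 by omega] at h
    exact Nat.eq_one_of_dvd_coprimes hthree hdvd (Nat.gcd_dvd_left _ _)
  refine ⟨?_, fun j hj hjn => by omega⟩
  rw [a_succ_of_even (by omega) (by omega), h₂, if_neg]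
  · omega
  · rw [show m + 2 - 1 = m + 1 by omega, Nat.gcd_eq_left ⟨2, by ring⟩]
    omega

theorem two_mul_minFac_le {q r : ℕ} (hr : 20 ≤ r) (hq : 0 < q) (hqr : q ≤ 2 * r - 5)
    (h : ¬ q.Prime) : 2 * q.minFac + 6 ≤ r := by
  have hsq := Nat.minFac_sq_le_self hq h
  obtain ⟨t, rfl⟩ := Nat.exists_eq_add_of_le hr
  have : q.minFac ^ 2 ≤ 2 * t + 35 := by omega
  by_contra! hlt
  nlinarith

/-- A run that survives from its reset point `r` up to `2 * r - 6` certifies twin primes. -/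
theorem IsRun.prime_and_prime {r : ℕ} (hr : 20 ≤ r) (h : IsRun r (2 * r - 6)) :
    Nat.Prime (2 * r - 7) ∧ Nat.Prime (2 * r - 5) := by
  obtain ⟨-, hrun⟩ := h
  constructor
  · by_contra hq
    have hle := two_mul_minFac_le hr (by omega) (by omega) hq
    have hp := Nat.minFac_prime (show 2 * r - 7 ≠ 1 by omega)
    have hpq := Nat.minFac_dvd (2 * r - 7)
    set p := (2 * r - 7).minFac
    have hdiv := Nat.div_add_mod (2 * r - 6) (2 * p)
    have hlt := Nat.mod_lt (2 * r - 6) (show 2 * p > 0 by have := hp.pos; omega)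
    set d := (2 * r - 6) / (2 * p)
    have hcop := (hrun (2 * p * d) (by omega) (by omega)).1 (by rw [mul_assoc]; omega)
    exact hp.ne_one (Nat.eq_one_of_dvd_coprimes hcop ⟨2 * d, by ring⟩ hpq)
  · by_contra hq
    have hle := two_mul_minFac_le hr (by omega) le_rfl hq
    have hp := Nat.minFac_prime (show 2 * r - 5 ≠ 1 by omega)
    have hpq := Nat.minFac_dvd (2 * r - 5)
    set p := (2 * r - 5).minFac
    have hodd : p % 2 = 1 := by
      refine hp.eq_two_or_odd.resolve_left fun h2 => ?_
      rw [h2] at hpq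
      omega
    have hdiv := Nat.div_add_mod (2 * r - 8 - p) (2 * p)
    have hlt := Nat.mod_lt (2 * r - 8 - p) (show 2 * p > 0 by have := hp.pos; omega)
    set d := (2 * r - 8 - p) / (2 * p)
    have hcop := (hrun (p + 2 * p * d + 2) (by omega) (by omega)).2 (by rw [mul_assoc]; omega)
    exact hp.ne_one (Nat.eq_one_of_dvd_coprimes hcop ⟨1 + 2 * d, by simp; ring⟩ hpq)

/-- If `m` is a fundamental point of `a` with `m ∓ 1` twin primes, and `m'` is the least
fundamental point of `a` greater than `m`, then `m' ∓ 1` are twin primes as well. -/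
theorem next_fundamental_point_a_gives_twin_primes
    (m m' : ℕ) (hm : IsFundamentalA m)
    (hp : Nat.Prime (m - 1)) (hp' : Nat.Prime (m + 1))
    (hm' : IsFundamentalA m') (hlt : m < m')
    (hleast : ∀ k : ℕ, IsFundamentalA k → m < k → m' ≤ k) :
    Nat.Prime (m' - 1) ∧ Nat.Prime (m' + 1) := by
  obtain ⟨hm₁, hmod, -⟩ := id hm
  obtain ⟨-, hmod', ha'⟩ := hm'
  obtain ⟨r, hmr, -, hrun⟩ := exists_isRun (by omega) hm.isRun_add_three
    (show m + 3 ≤ m' by omega)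
  have hr : m' = 2 * r - 6 := by
    have := hrun.1
    omega
  subst hr
  have h := hrun.prime_and_prime (by omega)
  rwa [show 2 * r - 6 - 1 = 2 * r - 7 by omega, show 2 * r - 6 + 1 = 2 * r - 5 by omega]
end

section
/- Let m > 3 be an integer. Then m - 2 and m are both prime if and only if c^{(m)}(n) = c^{(m)}(n-1) + 1 for every integer n with 2 ≤ n ≤ m (i.e., all increments of the sequence c^{(m)} on the set {1, ..., m} are trivial). -/
/-- The sequence `c⁽ᵐ⁾` from the paper: `cm m 1 = m` and, for `n ≥ 2`,
`cm m n = cm m (n-1) + gcd (n, cm m (n-1))` if `n` is even, and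
`cm m n = cm m (n-1) + gcd (n-2, cm m (n-1))` if `n` is odd. -/
def cm (m : ℕ) : ℕ → ℕ
  | 0 => m
  | 1 => m
  | n + 2 =>
    cm m (n + 1) +
      (if (n + 2) % 2 = 0 then Nat.gcd (n + 2) (cm m (n + 1))
       else Nat.gcd n (cm m (n + 1)))

theorem cm_add_two (m k : ℕ) :
    cm m (k + 2) = cm m (k + 1) +
      (if (k + 2) % 2 = 0 then Nat.gcd (k + 2) (cm m (k + 1))
       else Nat.gcd k (cm m (k + 1))) := by
  rw [cm]

/-- While the sequence has grown only by trivial increments, the next increment is a gcd with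
`m - 2` or with `m`, according to parity. -/
theorem cm_add_two_of_eq {m k : ℕ} (hm : 2 ≤ m) (h : cm m (k + 1) = m + k) :
    cm m (k + 2) = cm m (k + 1) +
      (if k % 2 = 0 then Nat.gcd (k + 2) (m - 2) else Nat.gcd k m) := by
  have hk : m + k = (m - 2) + (k + 2) := by omega
  rw [cm_add_two, h, Nat.add_mod_right, Nat.gcd_add_self_right, hk, Nat.gcd_add_self_right]

/-- All increments on `{1, ..., m}` are trivial iff the corresponding gcds with `m - 2` and `m`
are all `1`. -/
theorem forall_cm_eq_add_one_iff {m : ℕ} (hm : 2 ≤ m) :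
    (∀ n : ℕ, 2 ≤ n → n ≤ m → cm m n = cm m (n - 1) + 1) ↔
      ∀ k : ℕ, k + 2 ≤ m →
        (if k % 2 = 0 then Nat.gcd (k + 2) (m - 2) else Nat.gcd k m) = 1 := by
  constructor
  · intro h
    have hc : ∀ k, k + 1 ≤ m → cm m (k + 1) = m + k := by
      intro k
      induction k with
      | zero => intro _; simp [cm]
      | succ k ih =>
        intro hk
        have h1 := h (k + 2) (by omega) hk
        have h2 := ih (by omega)
        simp only [Nat.add_succ_sub_one] at h1
        rw [h1, h2, Nat.add_assoc]
    intro k hk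
    have h1 := cm_add_two_of_eq hm (hc k (by omega))
    have h2 := h (k + 2) (by omega) hk
    simp only [Nat.add_succ_sub_one] at h2
    omega
  · intro h
    have hc : ∀ k, k + 1 ≤ m → cm m (k + 1) = m + k := by
      intro k
      induction k with
      | zero => intro _; simp [cm]
      | succ k ih =>
        intro hk
        have h2 := ih (by omega)
        have h1 := cm_add_two_of_eq hm h2
        rw [h k hk, h2, Nat.add_assoc] at h1
        exact h1
    intro n hn hnm
    obtain ⟨k, rfl⟩ := Nat.exists_eq_add_of_le' hn
    rw [cm_add_two_of_eq hm (hc k (by omega)), h k hnm]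
    simp

/-- Criterion: an integer `m > 3` is the greater of a pair of twin primes
(`m - 2` and `m` are both prime) if and only if all increments of `c⁽ᵐ⁾` on
`{1, ..., m}` are trivial. -/
theorem twin_prime_criterion (m : ℕ) (hm : 3 < m) :
    (Nat.Prime (m - 2) ∧ Nat.Prime m) ↔
      ∀ n : ℕ, 2 ≤ n → n ≤ m → cm m n = cm m (n - 1) + 1 := by
  rw [forall_cm_eq_add_one_iff (by omega)]
  constructor
  · rintro ⟨hp, hq⟩ k hk
    have hodd : m % 2 = 1 := hq.eq_two_or_odd.resolve_left (by omega)
    split_ifs with hk2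
    · refine Nat.Coprime.symm ((Nat.Prime.coprime_iff_not_dvd hp).2 ?_)
      rintro ⟨c, hc⟩
      match c with
      | 0 => omega
      | 1 => omega
      | c + 2 =>
        have : (m - 2) * 2 ≤ (m - 2) * (c + 2) := Nat.mul_le_mul_left _ (by omega)
        omega
    · exact Nat.Coprime.symm
        ((Nat.Prime.coprime_iff_not_dvd hq).2 (Nat.not_dvd_of_pos_of_lt (by omega) (by omega)))
  · intro h
    have hodd : m % 2 = 1 := by
      by_contra hm2
      have h0 := h 0 (by omega)
      have h2 : 2 ∣ Nat.gcd 2 (m - 2) := Nat.dvd_gcd dvd_rfl (by omega)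
      simp only [Nat.zero_mod, if_true, Nat.zero_add] at h0
      omega
    have odd_factor : ∀ {a p : ℕ}, a % 2 = 1 → p ∣ a → p % 2 = 1 := fun ha hpa =>
      Nat.odd_iff.1 ((Nat.odd_iff.2 ha).of_dvd_nat hpa)
    constructor
    · by_contra hn
      have hp := Nat.minFac_prime (n := m - 2) (by omega)
      have hd := Nat.minFac_dvd (m - 2)
      have hsq := Nat.minFac_sq_le_self (n := m - 2) (by omega) hn
      generalize (m - 2).minFac = p at hp hd hsq
      have := hp.two_le
      have hle : 2 * p ≤ m - 2 := by nlinarith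
      have hk := h (2 * p - 2) (by omega)
      rw [if_pos (by omega), Nat.sub_add_cancel (by omega)] at hk
      exact Nat.not_coprime_of_dvd_of_dvd hp.one_lt (Nat.dvd_mul_left p 2) hd hk
    · by_contra hn
      have hp := Nat.minFac_prime (n := m) (by omega)
      have hd := Nat.minFac_dvd m
      have hsq := Nat.minFac_sq_le_self (n := m) (by omega) hn
      generalize m.minFac = p at hp hd hsq
      have := odd_factor hodd hd
      have := hp.two_le
      have hle : p + 2 ≤ m := by nlinarith
      have hk := h p hle
      rw [if_neg (by omega)] at hk
      exact Nat.not_coprime_of_dvd_of_dvd hp.one_lt dvd_rfl hd hk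
end

section
/- Let m ≥ 6 with m ≡ 0 (mod 6) be a fundamental point of c, and let m' > m be the least fundamental point of c greater than m. Suppose the only index n with m < n ≤ m' at which c(n) - c(n-1) > 1 is n = m + 3. Then (i) m' = 2m, and (ii) if m - 1 and m + 1 are both prime, then 2m - 1 and 2m + 1 are both prime as well (so that with p = m - 1 all four numbers p, p + 2, 2p + 1, 2p + 3 are prime). -/
/-- The sequence `c` from the paper: `c 1 = 2` and, for `n ≥ 2`,
`c n = c (n-1) + gcd (n, c (n-1))` if `n` is even, and
`c n = c (n-1) + gcd (n-2, c (n-1))` if `n` is odd. -/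
def c : ℕ → ℕ
  | 0 => 0
  | 1 => 2
  | n + 2 =>
    c (n + 1) +
      (if (n + 2) % 2 = 0 then Nat.gcd (n + 2) (c (n + 1)) else Nat.gcd n (c (n + 1)))

/-- A fundamental point of `c`: an integer `n ≥ 2` with `c n = 2 n`. -/
def IsFundamentalC (n : ℕ) : Prop := 2 ≤ n ∧ c n = 2 * n

theorem c_add_two_of_even {n : ℕ} (hn : n % 2 = 0) :
    c (n + 2) = c (n + 1) + Nat.gcd (n + 2) (c (n + 1)) := by
  rw [c, if_pos (by omega)]

theorem c_add_two_of_odd {n : ℕ} (hn : n % 2 = 1) :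
    c (n + 2) = c (n + 1) + Nat.gcd n (c (n + 1)) := by
  rw [c, if_neg (by omega)]

theorem c_lt_c_add_two (n : ℕ) : c (n + 1) < c (n + 2) := by
  rcases Nat.mod_two_eq_zero_or_one n with h | h
  · rw [c_add_two_of_even h]
    exact Nat.lt_add_of_pos_right (Nat.gcd_pos_of_pos_left _ (by omega))
  · rw [c_add_two_of_odd h]
    exact Nat.lt_add_of_pos_right (Nat.gcd_pos_of_pos_left _ (by omega))

theorem c_add_one_of_fundamental {m : ℕ} (hm : 2 ≤ m) (heven : m % 2 = 0) (hfund : c m = 2 * m) :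
    c (m + 1) = 2 * m + 1 := by
  obtain ⟨k, rfl⟩ : ∃ k, m = k + 1 := ⟨m - 1, by omega⟩
  have hodd : k.Coprime 2 := Nat.coprime_two_right.2 (Nat.odd_iff.2 (by omega))
  have hgcd : Nat.gcd k (2 * (k + 1)) = 1 := Nat.Coprime.mul_right hodd (by simp)
  rw [c_add_two_of_odd (by omega), hfund, hgcd]

theorem c_add_two_of_fundamental {m : ℕ} (hm : 6 ≤ m) (hmod : m % 6 = 0) (hfund : c m = 2 * m) :
    c (m + 2) = 2 * m + 2 := by
  have hgcd : Nat.gcd (m + 2) (2 * m + 1) = 1 := by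
    have hdvd : Nat.gcd (m + 2) (2 * m + 1) ∣ 3 := by
      have h := Nat.dvd_sub ((Nat.gcd_dvd_left (m + 2) (2 * m + 1)).mul_left 2)
        (Nat.gcd_dvd_right (m + 2) (2 * m + 1))
      rwa [show 2 * (m + 2) - (2 * m + 1) = 3 by omega] at h
    rcases (Nat.dvd_prime Nat.prime_three).1 hdvd with h | h
    · exact h
    · have h3 : 3 ∣ m + 2 := h ▸ Nat.gcd_dvd_left (m + 2) (2 * m + 1)
      omega
  rw [c_add_two_of_even (by omega), c_add_one_of_fundamental (by omega) (by omega) hfund, hgcd]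

theorem c_add_three_of_fundamental {m : ℕ} (hm : 6 ≤ m) (hmod : m % 6 = 0)
    (hfund : c m = 2 * m) : c (m + 3) = 3 * m + 3 := by
  have h := c_add_two_of_odd (n := m + 1) (by omega)
  rw [show m + 1 + 1 = m + 2 from rfl, c_add_two_of_fundamental hm hmod hfund,
    show 2 * m + 2 = (m + 1) * 2 by ring, Nat.gcd_mul_right_right] at h
  rw [show m + 3 = m + 1 + 2 from rfl, h]
  ring

theorem c_eq_add_of_unit_increments {a d N : ℕ} (ha : c a = a + d)
    (hinc : ∀ n, a < n → n ≤ N → c n = c (n - 1) + 1) {n : ℕ} (han : a ≤ n) (hnN : n ≤ N) :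
    c n = n + d := by
  induction n, han using Nat.le_induction with
  | base => exact ha
  | succ n han ih =>
    rw [hinc (n + 1) (by omega) hnN, Nat.add_sub_cancel, ih (by omega)]
    ring

/-- A composite number coprime to `6` has a factor `p ≥ 5` with `5 * p` at most the
number. -/
theorem exists_dvd_five_mul_le {N : ℕ} (hN : 2 ≤ N) (h2 : N % 2 ≠ 0) (h3 : N % 3 ≠ 0)
    (hcomp : ¬ N.Prime) : ∃ p, 5 ≤ p ∧ p ∣ N ∧ 5 * p ≤ N := by
  have hp : N.minFac.Prime := Nat.minFac_prime (by omega)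
  have hdvd := Nat.minFac_dvd N
  have hsq := Nat.minFac_sq_le_self (by omega) hcomp
  have h5 : 5 ≤ N.minFac := by
    by_contra! hlt
    have := hp.two_le
    generalize N.minFac = p at *
    interval_cases p
    · omega
    · omega
    · exact absurd hp (by decide)
  exact ⟨N.minFac, h5, hdvd, by nlinarith⟩

/-- If `m ≥ 6`, `m ≡ 0 (mod 6)`, is a fundamental point of `c` and `m'` is the next
fundamental point, and the only nontrivial increment in between is the main increment at
`m + 3`, then `m' = 2 m`; moreover if `m ∓ 1` are twin primes then so are `2 m ∓ 1`. -/
theorem next_fundamental_point_only_main_increment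
    (m m' : ℕ) (h6 : 6 ≤ m) (hmod : m % 6 = 0) (hfund : c m = 2 * m)
    (hm' : IsFundamentalC m') (hlt : m < m')
    (hleast : ∀ k : ℕ, IsFundamentalC k → m < k → m' ≤ k)
    (honly : ∀ n : ℕ, m < n → n ≤ m' → 1 < c n - c (n - 1) → n = m + 3) :
    m' = 2 * m ∧
      (Nat.Prime (m - 1) ∧ Nat.Prime (m + 1) →
        Nat.Prime (2 * m - 1) ∧ Nat.Prime (2 * m + 1)) := by
  have hinc : ∀ n, m + 3 < n → n ≤ m' → c n = c (n - 1) + 1 := by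
    intro n hn hnm
    have hlt := c_lt_c_add_two (n - 2)
    rw [show n - 2 + 1 = n - 1 by omega, show n - 2 + 2 = n by omega] at hlt
    by_contra hne
    have := honly n (by omega) hnm (by omega)
    omega
  have h1 := c_add_one_of_fundamental (by omega) (by omega) hfund
  have h2 := c_add_two_of_fundamental h6 hmod hfund
  have h3 := c_add_three_of_fundamental h6 hmod hfund
  have hc : ∀ n, m + 3 ≤ n → n ≤ m' → c n = n + 2 * m := fun n hn hnm =>
    c_eq_add_of_unit_increments (by omega) hinc hn hnm
  have hm'eq : m' = 2 * m := by
    have hfund' := hm'.2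
    have hne1 : m' ≠ m + 1 := by rintro rfl; omega
    have hne2 : m' ≠ m + 2 := by rintro rfl; omega
    have := hc m' (by omega) le_rfl
    omega
  refine ⟨hm'eq, fun _ => ?_⟩
  rcases Nat.lt_or_ge m 12 with hsmall | hlarge
  · obtain rfl : m = 6 := by omega
    norm_num
  have hcop_even : ∀ n, m + 2 ≤ n → n + 2 ≤ 2 * m → n % 2 = 0 →
      Nat.gcd (n + 2) (n + 1 + 2 * m) = 1 := by
    intro n hn hnm hpar
    have h := c_add_two_of_even hpar
    rw [hc (n + 1) (by omega) (by omega), hc (n + 2) (by omega) (by omega)] at h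
    omega
  have hcop_odd : ∀ n, m + 2 ≤ n → n + 2 ≤ 2 * m → n % 2 = 1 →
      Nat.gcd n (n + 1 + 2 * m) = 1 := by
    intro n hn hnm hpar
    have h := c_add_two_of_odd hpar
    rw [hc (n + 1) (by omega) (by omega), hc (n + 2) (by omega) (by omega)] at h
    omega
  constructor
  · by_contra hcomp
    obtain ⟨p, hp5, hpdvd, hple⟩ :=
      exists_dvd_five_mul_le (by omega) (by omega) (by omega) hcomp
    have hpodd : p % 2 = 1 := by
      by_contra hpar
      have : 2 ∣ 2 * m - 1 := (show 2 ∣ p by omega).trans hpdvd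
      omega
    obtain ⟨n, hn⟩ : ∃ n, n + 2 = 2 * m - 1 - p := ⟨2 * m - 1 - p - 2, by omega⟩
    have hdvd : p ∣ n + 2 := hn ▸ Nat.dvd_sub hpdvd dvd_rfl
    have hdvd' : p ∣ n + 1 + 2 * m := by
      rw [show n + 1 + 2 * m = (n + 2) + (2 * m - 1) by omega]
      exact dvd_add hdvd hpdvd
    have := Nat.dvd_gcd hdvd hdvd'
    rw [hcop_even n (by omega) (by omega) (by omega), Nat.dvd_one] at this
    omega
  · by_contra hcomp
    obtain ⟨p, hp5, hpdvd, hple⟩ :=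
      exists_dvd_five_mul_le (by omega) (by omega) (by omega) hcomp
    obtain ⟨n, hn⟩ : ∃ n, n = 2 * m + 1 - 2 * p := ⟨_, rfl⟩
    have hdvd : p ∣ n := hn ▸ Nat.dvd_sub hpdvd (dvd_mul_left p 2)
    have hdvd' : p ∣ n + 1 + 2 * m := by
      rw [show n + 1 + 2 * m = n + (2 * m + 1) by omega]
      exact dvd_add hdvd hpdvd
    have := Nat.dvd_gcd hdvd hdvd'
    rw [hcop_odd n (by omega) (by omega) (by omega), Nat.dvd_one] at this
    omega
end

section
/- Let m ≥ 6 with m ≡ 0 (mod 6) be a fundamental point of c such that m - 1 and m + 1 are both prime, and let m' be the least fundamental point of c with m' > m (assuming one exists). Then, writing p₁ = m + 1 and p₂ = m' + 1 for the greater members of the associated twin prime pairs, one has p₂ ≥ 2p₁ - 1. -/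
theorem c_of_even (n : ℕ) (h : n % 2 = 0) :
    c (n + 2) = c (n + 1) + Nat.gcd (n + 2) (c (n + 1)) := by
  rw [c, if_pos (by omega)]

theorem c_of_odd (n : ℕ) (h : n % 2 = 1) :
    c (n + 2) = c (n + 1) + Nat.gcd n (c (n + 1)) := by
  rw [c, if_neg (by omega)]

theorem c_add_one_le_succ (n : ℕ) : c (n + 1) + 1 ≤ c (n + 2) := by
  rcases Nat.mod_two_eq_zero_or_one n with h | h
  · rw [c_of_even n h]
    have := Nat.gcd_pos_of_pos_left (c (n + 1)) (show 0 < n + 2 by omega)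
    omega
  · rw [c_of_odd n h]
    have := Nat.gcd_pos_of_pos_left (c (n + 1)) (show 0 < n by omega)
    omega

theorem c_add_le (n k : ℕ) : c (n + 1) + k ≤ c (n + 1 + k) := by
  induction k with
  | zero => simp
  | succ k ih =>
    have := c_add_one_le_succ (n + k)
    rw [show n + k + 1 = n + 1 + k by omega, show n + k + 2 = n + 1 + (k + 1) by omega] at this
    omega

/-- After a fundamental point `m` divisible by `6`, the sequence has increments `1, 1, m + 1`. -/
theorem c_after_fundamental (m : ℕ) (hm : 0 < m) (hmod : m % 6 = 0) (hfund : c m = 2 * m) :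
    c (m + 1) = 2 * m + 1 ∧ c (m + 2) = 2 * m + 2 ∧ c (m + 3) = 3 * m + 3 := by
  obtain ⟨n, rfl⟩ : ∃ n, m = n + 1 := ⟨m - 1, by omega⟩
  have gcd_one : Nat.gcd n (2 * (n + 1)) = 1 := by
    have hdvd : Nat.gcd n (2 * (n + 1)) ∣ 2 := by
      rw [show 2 * (n + 1) = 2 * n + 2 by ring, Nat.gcd_mul_right_add_right]
      exact Nat.gcd_dvd_right n 2
    rcases (Nat.dvd_prime Nat.prime_two).mp hdvd with h | h
    · exact h
    · have := Nat.gcd_dvd_left n (2 * (n + 1))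
      rw [h] at this
      omega
  have h1 : c (n + 2) = 2 * (n + 1) + 1 := by
    rw [c_of_odd n (by omega), hfund, gcd_one]
  have gcd_two : Nat.gcd (n + 3) (2 * (n + 1) + 1) = 1 := by
    have hdvd : Nat.gcd (n + 3) (2 * (n + 1) + 1) ∣ 3 := by
      have h := Nat.dvd_sub ((Nat.gcd_dvd_left (n + 3) (2 * (n + 1) + 1)).mul_left 2)
        (Nat.gcd_dvd_right (n + 3) (2 * (n + 1) + 1))
      rwa [show 2 * (n + 3) - (2 * (n + 1) + 1) = 3 by omega] at h
    rcases (Nat.dvd_prime Nat.prime_three).mp hdvd with h | h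
    · exact h
    · have := Nat.gcd_dvd_left (n + 3) (2 * (n + 1) + 1)
      rw [h] at this
      omega
  have h2 : c (n + 3) = 2 * (n + 1) + 2 := by
    rw [c_of_even (n + 1) (by omega), h1, gcd_two]
  refine ⟨h1, h2, ?_⟩
  rw [c_of_odd (n + 2) (by omega), h2,
    show 2 * (n + 1) + 2 = (n + 2) * 2 by ring, Nat.gcd_mul_right_right]
  ring

/-- If `m ≥ 6`, `m ≡ 0 (mod 6)`, is a fundamental point of `c` with `m ∓ 1` twin primes,
and `m'` is the least fundamental point of `c` greater than `m`, then the greater twin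
members `p₁ = m + 1` and `p₂ = m' + 1` satisfy `p₂ ≥ 2 p₁ - 1`. -/
theorem consecutive_greater_twins_estimate
    (m m' : ℕ) (h6 : 6 ≤ m) (hmod : m % 6 = 0) (hfund : c m = 2 * m)
    (hp : Nat.Prime (m - 1)) (hp' : Nat.Prime (m + 1))
    (hm' : IsFundamentalC m') (hlt : m < m')
    (hleast : ∀ k : ℕ, IsFundamentalC k → m < k → m' ≤ k) :
    2 * (m + 1) - 1 ≤ m' + 1 := by
  obtain ⟨h1, h2, h3⟩ := c_after_fundamental m (by omega) hmod hfund
  obtain ⟨-, hm'⟩ := hm'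
  have hne1 : m' ≠ m + 1 := by
    rintro rfl
    omega
  have hne2 : m' ≠ m + 2 := by
    rintro rfl
    omega
  obtain ⟨k, rfl⟩ : ∃ k, m' = m + 2 + 1 + k := ⟨m' - (m + 3), by omega⟩
  have hgrowth : c (m + 3) + k ≤ c (m + 2 + 1 + k) := c_add_le (m + 2) k
  omega
end

section
/- Let n₀ ≥ 2 and k ≥ 1 be integers such that c(n₀ + i) = c(n₀ + i - 1) + 1 for all 1 ≤ i ≤ k - 1, and set h = c(n₀ + k) - c(n₀ + k - 1). Let δ = 0 if n₀ + k is even and δ = 2 if n₀ + k is odd. Then h divides c(n₀) - n₀ + δ - 1, and h divides 2k - (c(n₀) - 3n₀) + 1 - 3δ. -/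
theorem c_add_of_trivial_increments (n₀ m : ℕ)
    (htriv : ∀ i : ℕ, 1 ≤ i → i ≤ m → c (n₀ + i) = c (n₀ + i - 1) + 1) :
    c (n₀ + m) = c n₀ + m := by
  induction m with
  | zero => rfl
  | succ m ih =>
    have hstep := htriv (m + 1) (by omega) le_rfl
    rw [show n₀ + (m + 1) - 1 = n₀ + m by omega,
      ih fun i hi him => htriv i hi (by omega)] at hstep
    omega

/-- Rowland-type divisibility: if all increments of `c` at `n₀ + 1, ..., n₀ + k - 1` are
trivial and `h = c (n₀ + k) - c (n₀ + k - 1)`, then, with `δ = 0` if `n₀ + k` is even and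
`δ = 2` if `n₀ + k` is odd, `h` divides `c n₀ - n₀ + δ - 1` and `h` divides
`2 k - (c n₀ - 3 n₀) + 1 - 3 δ`. -/
theorem increment_divisibility (n₀ k : ℕ) (hn₀ : 2 ≤ n₀) (hk : 1 ≤ k)
    (htriv : ∀ i : ℕ, 1 ≤ i → i ≤ k - 1 → c (n₀ + i) = c (n₀ + i - 1) + 1) :
    ((c (n₀ + k) : ℤ) - (c (n₀ + k - 1) : ℤ)) ∣
        ((c n₀ : ℤ) - (n₀ : ℤ) + (if Even (n₀ + k) then (0 : ℤ) else 2) - 1) ∧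
      ((c (n₀ + k) : ℤ) - (c (n₀ + k - 1) : ℤ)) ∣
        (2 * (k : ℤ) - ((c n₀ : ℤ) - 3 * (n₀ : ℤ)) + 1 -
          3 * (if Even (n₀ + k) then (0 : ℤ) else 2)) := by
  obtain ⟨m, rfl⟩ : ∃ m, k = m + 1 := ⟨k - 1, by omega⟩
  obtain ⟨a, rfl⟩ : ∃ a, n₀ = a + 1 := ⟨n₀ - 1, by omega⟩
  have hsum := c_add_of_trivial_increments (a + 1) m htriv
  have hrec : c (a + m + 2) = c (a + m + 1) +
      (if (a + m + 2) % 2 = 0 then Nat.gcd (a + m + 2) (c (a + m + 1))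
        else Nat.gcd (a + m) (c (a + m + 1))) := by
    rw [c]
  rw [show a + 1 + m = a + m + 1 by omega] at hsum
  rw [show a + 1 + (m + 1) = a + m + 2 by omega, show a + m + 2 - 1 = a + m + 1 by omega]
  set δ : ℤ := if Even (a + m + 2) then 0 else 2 with hδ
  set h : ℤ := (c (a + m + 2) : ℤ) - c (a + m + 1) with hh
  have hdvd : h ∣ (a + m + 2 : ℤ) - δ ∧ h ∣ (c (a + m + 1) : ℤ) := by
    simp only [hh, hrec, hδ, Nat.even_iff]
    push_cast
    rw [add_sub_cancel_left]
    split_ifs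
    · exact ⟨by simpa using mod_cast Nat.gcd_dvd_left (a + m + 2) (c (a + m + 1)),
        mod_cast Nat.gcd_dvd_right _ _⟩
    · rw [add_sub_cancel_right]
      exact ⟨mod_cast Nat.gcd_dvd_left _ _, mod_cast Nat.gcd_dvd_right _ _⟩
  obtain ⟨h_index, h_value⟩ := hdvd
  rw [hsum] at h_value
  push_cast at h_value ⊢
  constructor
  · exact (dvd_sub h_value h_index).trans (dvd_of_eq (by ring))
  · exact (dvd_sub (h_index.mul_left 3) h_value).trans (dvd_of_eq (by ring))
end

section
/- Let m ≥ 6 be an integer with m ≡ 0 (mod 6) such that c(m) = 2m. Then c(m+1) = 2m + 1, c(m+2) = 2m + 2, and c(m+3) = 3m + 3; in particular the increment c(m+3) - c(m+2) equals m + 1. -/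
/-- After a fundamental point `m ≥ 6` with `m ≡ 0 (mod 6)`, the sequence `c` takes the
values `c (m+1) = 2m + 1`, `c (m+2) = 2m + 2`, and `c (m+3) = 3m + 3`; in particular the
increment at `m + 3` equals `m + 1`. -/
theorem main_increment_after_fundamental_point
    (m : ℕ) (h6 : 6 ≤ m) (hmod : m % 6 = 0) (hfund : c m = 2 * m) :
    c (m + 1) = 2 * m + 1 ∧ c (m + 2) = 2 * m + 2 ∧ c (m + 3) = 3 * m + 3 ∧
      c (m + 3) - c (m + 2) = m + 1 := by
  obtain ⟨k, rfl⟩ : ∃ k, m = k + 1 := ⟨m - 1, by omega⟩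
  have g₁ : Nat.gcd k (2 * (k + 1)) = 1 := by
    have hk : k.Coprime 2 := Nat.coprime_two_right.mpr (Nat.odd_iff.mpr (by omega))
    rw [show 2 * (k + 1) = 2 + k * 2 by ring, Nat.gcd_add_mul_left_right]
    exact hk
  have g₂ : Nat.gcd (k + 3) (2 * (k + 1) + 1) = 1 := by
    have h3 : ¬ 3 ∣ Nat.gcd (k + 3) (2 * (k + 1) + 1) := fun h => by
      have := h.trans (Nat.gcd_dvd_left _ _)
      omega
    have hd : Nat.gcd (k + 3) (2 * (k + 1) + 1) ∣ 3 := by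
      have h := Nat.dvd_sub ((Nat.gcd_dvd_left (k + 3) (2 * (k + 1) + 1)).mul_left 2)
        (Nat.gcd_dvd_right (k + 3) (2 * (k + 1) + 1))
      rwa [show 2 * (k + 3) - (2 * (k + 1) + 1) = 3 by omega] at h
    rcases (Nat.dvd_prime Nat.prime_three).mp hd with h | h
    · exact h
    · exact absurd (dvd_of_eq h.symm) h3
  have g₃ : Nat.gcd (k + 2) (2 * (k + 1) + 2) = k + 2 :=
    Nat.gcd_eq_left ⟨2, by ring⟩
  have h₁ : c (k + 2) = 2 * (k + 1) + 1 := by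
    rw [c, if_neg (by omega), hfund, g₁]
  have h₂ : c (k + 3) = 2 * (k + 1) + 2 := by
    rw [c, if_pos (by omega), h₁, g₂]
  have h₃ : c (k + 4) = 3 * (k + 1) + 3 := by
    rw [c, if_neg (by omega), h₂, g₃]
    ring
  refine ⟨h₁, h₂, h₃, ?_⟩
  change c (k + 4) - c (k + 3) = _
  omega
end

section
/- Let m ≥ 180 be an integer with m ≡ 0 (mod 6) such that a(m) = 2m. Then a(m+1) = 2m + 1, a(m+2) = 2m + 2, and a(m+3) = 3m + 3 = 3((m+3) - 2); in particular m + 3 is a point of a nontrivial (main) increment of a. -/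
theorem coprime_pred_two_mul {m : ℕ} (hpos : 0 < m) (heven : m % 2 = 0) :
    Nat.Coprime (m - 1) (2 * m) := by
  have h : 2 * m = 2 + 2 * (m - 1) := by omega
  rw [h, Nat.coprime_add_mul_right_right, Nat.coprime_two_right, Nat.odd_iff]
  omega

theorem coprime_add_two_two_mul_add_one {m : ℕ} (hmod : m % 3 = 0) :
    Nat.Coprime (m + 2) (2 * m + 1) := by
  have h : Nat.Coprime (m + 2) 3 := by
    rw [Nat.coprime_comm, Nat.Prime.coprime_iff_not_dvd Nat.prime_three]
    omega
  refine Nat.eq_one_of_dvd_coprimes h (Nat.gcd_dvd_left _ _) ?_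
  have hdvd := Nat.dvd_sub ((Nat.gcd_dvd_left (m + 2) (2 * m + 1)).mul_left 2)
    (Nat.gcd_dvd_right (m + 2) (2 * m + 1))
  rwa [show 2 * (m + 2) - (2 * m + 1) = 3 by omega] at hdvd

/-- After a fundamental point `m ≥ 180` with `m ≡ 0 (mod 6)` of the sequence `a`, one has
`a (m+1) = 2m + 1`, `a (m+2) = 2m + 2`, and `a (m+3) = 3m + 3 = 3 ((m+3) - 2)`;
in particular `m + 3` is a point of a nontrivial (main) increment of `a`. -/
theorem main_increment_after_fundamental_point_a
    (m : ℕ) (h180 : 180 ≤ m) (hmod : m % 6 = 0) (hfund : a m = 2 * m) :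
    a (m + 1) = 2 * m + 1 ∧ a (m + 2) = 2 * m + 2 ∧ a (m + 3) = 3 * m + 3 ∧
      3 * m + 3 = 3 * ((m + 3) - 2) ∧ 1 < a (m + 3) - a (m + 2) := by
  have h₁ : a (m + 1) = 2 * m + 1 := by
    rw [a_succ h180, hfund, if_neg (by omega : ¬(m + 1) % 2 = 0),
      if_pos (coprime_pred_two_mul (by omega) (by omega))]
  have h₂ : a (m + 2) = 2 * m + 2 := by
    rw [a_succ (by omega : 180 ≤ m + 1), h₁, if_pos (by omega : (m + 1 + 1) % 2 = 0),
      if_pos (coprime_add_two_two_mul_add_one (by omega))]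
  have h₃ : a (m + 3) = 3 * m + 3 := by
    have hgcd : Nat.gcd (m + 2 - 1) (2 * m + 2) = m + 1 :=
      Nat.gcd_eq_left (Dvd.intro_left 2 (by omega))
    rw [a_succ (by omega : 180 ≤ m + 2), h₂, if_neg (by omega : ¬(m + 2 + 1) % 2 = 0),
      if_neg (by rw [hgcd]; omega)]
    omega
  exact ⟨h₁, h₂, h₃, by omega, by omega⟩
end
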